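/- For real numbers α, β, μ, ν > 0, we have ∫_0^∞ x^{μ-1} e^{-βx} Γ(ν, αx) dx = (α^ν Γ(μ+ν)) / (μ (α+β)^{μ+ν}) · ₂F₁(1, μ+ν; μ+1; β/(α+β)), where Γ(ν, z) is the upper incomplete gamma function and ₂F₁ is the Gauss hypergeometric function. -/

import Mathlib

open MeasureTheory

/-- The Gauss hypergeometric function `₂F₁(a,b;c;x)`. -/
noncomputable def gaussHypergeom (a b c x : ℝ) : ℝ :=
  ∑' k : ℕ, (ascPochhammer ℝ k).eval a * (ascPochhammer ℝ k).eval b /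
      (ascPochhammer ℝ k).eval c * x ^ k / (Nat.factorial k)

/-- The upper incomplete gamma function `Γ(ν, z) = ∫_z^∞ t^(ν-1) e^(-t) dt`. -/
noncomputable def upperIncGamma (ν z : ℝ) : ℝ :=
  ∫ t in Set.Ioi z, t ^ (ν - 1) * Real.exp (-t)

open Set Filter Topology

lemma integrableOn_rpow_mul_exp_neg_mul {s b : ℝ} (hs : 0 < s) (hb : 0 < b) :
    IntegrableOn (fun x : ℝ ↦ x ^ (s - 1) * Real.exp (-b * x)) (Ioi 0) := by
  simpa using integrableOn_rpow_mul_exp_neg_mul_rpow (p := 1) (s := s - 1) (b := b)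
    (by linarith) one_pos hb

lemma integral_rpow_mul_exp_neg_mul {s b : ℝ} (hs : 0 < s) (hb : 0 < b) :
    ∫ x in Ioi (0 : ℝ), x ^ (s - 1) * Real.exp (-b * x) = Real.Gamma s / b ^ s := by
  have h := Real.integral_rpow_mul_exp_neg_mul_Ioi hs hb
  simp only [← neg_mul] at h
  rw [h, one_div, Real.inv_rpow hb.le, inv_mul_eq_div]

lemma upperIncGamma_nonneg (ν : ℝ) {z : ℝ} (hz : 0 ≤ z) : 0 ≤ upperIncGamma ν z :=
  setIntegral_nonneg measurableSet_Ioi fun _ ht ↦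
    mul_nonneg (Real.rpow_nonneg (hz.trans (le_of_lt ht)) _) (Real.exp_pos _).le

lemma integrableOn_rpow_mul_exp_neg {ν z : ℝ} (hν : 0 < ν) (hz : 0 ≤ z) :
    IntegrableOn (fun t : ℝ ↦ t ^ (ν - 1) * Real.exp (-t)) (Ioi z) := by
  simpa using (integrableOn_rpow_mul_exp_neg_mul hν one_pos).mono_set (Ioi_subset_Ioi hz)

lemma exists_upperIncGamma_le_mul_exp {ν : ℝ} (hν : 0 < ν) :
    ∃ C : ℝ, 0 ≤ C ∧ ∀ z, 0 ≤ z → upperIncGamma ν z ≤ C * Real.exp (-(z / 2)) := by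
  have hint := integrableOn_rpow_mul_exp_neg_mul hν (one_half_pos (α := ℝ))
  have hnn : ∀ t ∈ Ioi (0 : ℝ), 0 ≤ t ^ (ν - 1) * Real.exp (-(1 / 2) * t) := fun _ ht ↦
    mul_nonneg (Real.rpow_nonneg (le_of_lt ht) _) (Real.exp_pos _).le
  refine ⟨_, setIntegral_nonneg (μ := volume) measurableSet_Ioi hnn, fun z hz ↦ ?_⟩
  calc upperIncGamma ν z
      ≤ ∫ t in Ioi z, t ^ (ν - 1) * Real.exp (-(1 / 2) * t) * Real.exp (-(z / 2)) := by
        refine setIntegral_mono_on (integrableOn_rpow_mul_exp_neg hν hz)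
          ((hint.mono_set (Ioi_subset_Ioi hz)).mul_const _) measurableSet_Ioi fun t ht ↦ ?_
        have ht' : z < t := ht
        rw [mul_assoc, ← Real.exp_add]
        have : 0 ≤ t ^ (ν - 1) := Real.rpow_nonneg (by linarith) _
        gcongr
        linarith
    _ = (∫ t in Ioi z, t ^ (ν - 1) * Real.exp (-(1 / 2) * t)) * Real.exp (-(z / 2)) :=
        integral_mul_const _ _
    _ ≤ _ := mul_le_mul_of_nonneg_right
        (setIntegral_mono_set hint (ae_restrict_of_forall_mem measurableSet_Ioi hnn)
          (Ioi_subset_Ioi hz).eventuallyLE) (Real.exp_pos _).le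

lemma hasDerivAt_upperIncGamma {ν z : ℝ} (hν : 0 < ν) (hz : 0 < z) :
    HasDerivAt (upperIncGamma ν) (-(z ^ (ν - 1) * Real.exp (-z))) z := by
  have hcont : ContinuousOn (fun t : ℝ ↦ t ^ (ν - 1) * Real.exp (-t)) (Ioi 0) := fun t ht ↦
    ((Real.continuousAt_rpow_const _ _ (Or.inl (ne_of_gt ht))).mul
      (by fun_prop)).continuousWithinAt
  have hd : HasDerivAt (fun u ↦ ∫ t in z..u, t ^ (ν - 1) * Real.exp (-t))
      (z ^ (ν - 1) * Real.exp (-z)) z :=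
    intervalIntegral.integral_hasDerivAt_right (by simp)
      (hcont.stronglyMeasurableAtFilter isOpen_Ioi z hz)
      (hcont.continuousAt (Ioi_mem_nhds hz))
  refine (hd.const_sub (upperIncGamma ν z)).congr_of_eventuallyEq ?_
  filter_upwards [Ioi_mem_nhds hz] with u hu
  have := intervalIntegral.integral_interval_add_Ioi (integrableOn_rpow_mul_exp_neg hν hz.le)
    (integrableOn_rpow_mul_exp_neg hν (le_of_lt hu))
  simp only [upperIncGamma]
  linarith

section LaplaceTransform

variable {α β ν : ℝ}

lemma integrableOn_rpow_mul_exp_mul_upperIncGamma {s : ℝ} (hα : 0 < α) (hβ : 0 < β)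
    (hs : 0 < s) (hν : 0 < ν) :
    IntegrableOn (fun x ↦ x ^ (s - 1) * Real.exp (-β * x) * upperIncGamma ν (α * x)) (Ioi 0) := by
  obtain ⟨C, hC, hbound⟩ := exists_upperIncGamma_le_mul_exp hν
  have hcont : ContinuousOn (fun x : ℝ ↦ x ^ (s - 1) * Real.exp (-β * x) *
      upperIncGamma ν (α * x)) (Ioi 0) := fun x hx ↦
    (((Real.continuousAt_rpow_const _ _ (Or.inl (ne_of_gt hx))).mul (by fun_prop)).mul
      ((hasDerivAt_upperIncGamma hν (mul_pos hα hx)).continuousAt.comp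
        (f := fun x ↦ α * x) (by fun_prop))).continuousWithinAt
  refine ((integrableOn_rpow_mul_exp_neg_mul hs hβ).mul_const C).mono'
    (hcont.aestronglyMeasurable measurableSet_Ioi)
    (ae_restrict_of_forall_mem measurableSet_Ioi fun x hx ↦ ?_)
  have hx' : 0 < x := hx
  have hz : 0 ≤ α * x := by positivity
  rw [Real.norm_of_nonneg (mul_nonneg (by positivity) (upperIncGamma_nonneg ν hz))]
  gcongr
  refine (hbound _ hz).trans (mul_le_of_le_one_right hC (Real.exp_le_one_iff.2 ?_))
  linarith

lemma exists_integral_upperIncGamma_le (hα : 0 < α) (hβ : 0 < β) (hν : 0 < ν) :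
    ∃ C : ℝ, ∀ s, 0 < s →
      ∫ x in Ioi (0 : ℝ), x ^ (s - 1) * Real.exp (-β * x) * upperIncGamma ν (α * x) ≤
        C * (Real.Gamma s / (β + α / 2) ^ s) := by
  obtain ⟨C, hC, hbound⟩ := exists_upperIncGamma_le_mul_exp hν
  refine ⟨C, fun s hs ↦ ?_⟩
  have hb : 0 < β + α / 2 := by positivity
  rw [← integral_rpow_mul_exp_neg_mul hs hb, ← integral_const_mul]
  refine setIntegral_mono_on (integrableOn_rpow_mul_exp_mul_upperIncGamma hα hβ hs hν)
    ((integrableOn_rpow_mul_exp_neg_mul hs hb).const_mul C) measurableSet_Ioi fun x hx ↦ ?_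
  have hx' : 0 < x := hx
  calc x ^ (s - 1) * Real.exp (-β * x) * upperIncGamma ν (α * x)
      ≤ x ^ (s - 1) * Real.exp (-β * x) * (C * Real.exp (-(α * x / 2))) := by
        gcongr
        exact hbound _ (by positivity)
    _ = C * (x ^ (s - 1) * (Real.exp (-β * x) * Real.exp (-(α * x / 2)))) := by ring
    _ = C * (x ^ (s - 1) * Real.exp (-(β + α / 2) * x)) := by
        rw [← Real.exp_add]
        ring_nf

lemma mul_integral_upperIncGamma_eq_add {s : ℝ} (hα : 0 < α) (hβ : 0 < β) (hs : 0 < s)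
    (hν : 0 < ν) :
    s * ∫ x in Ioi (0 : ℝ), x ^ (s - 1) * Real.exp (-β * x) * upperIncGamma ν (α * x) =
      β * (∫ x in Ioi (0 : ℝ),
        x ^ (s + 1 - 1) * Real.exp (-β * x) * upperIncGamma ν (α * x)) +
      α ^ ν * (Real.Gamma (s + ν) / (α + β) ^ (s + ν)) := by
  obtain ⟨C, hC, hbound⟩ := exists_upperIncGamma_le_mul_exp hν
  have hαβ : 0 < α + β := by positivity
  have hsν : 0 < s + ν := by positivity
  set G : ℝ → ℝ := fun x ↦ x ^ s * Real.exp (-β * x) * upperIncGamma ν (α * x) with hG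
  have hGnn : ∀ x, 0 ≤ x → 0 ≤ G x := fun x hx ↦
    mul_nonneg (by positivity) (upperIncGamma_nonneg ν (by positivity))
  have hGle : ∀ x, 0 ≤ x → G x ≤ x ^ s * Real.exp (-β * x) * C := fun x hx ↦ by
    have hz : 0 ≤ α * x := by positivity
    simp only [hG]
    gcongr
    refine (hbound _ hz).trans (mul_le_of_le_one_right hC (Real.exp_le_one_iff.2 ?_))
    linarith
  have hG0 : G 0 = 0 := by simp [hG, Real.zero_rpow hs.ne']
  have hcont : ContinuousWithinAt G (Ici 0) 0 := by
    have hlim : Tendsto (fun x : ℝ ↦ x ^ s * Real.exp (-β * x) * C) (𝓝[Ici 0] 0) (𝓝 0) := by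
      have : ContinuousAt (fun x : ℝ ↦ x ^ s * Real.exp (-β * x) * C) 0 :=
        ((Real.continuousAt_rpow_const _ _ (Or.inr hs.le)).mul (by fun_prop)).mul
          continuousAt_const
      simpa [Real.zero_rpow hs.ne'] using this.tendsto.mono_left nhdsWithin_le_nhds
    rw [ContinuousWithinAt, hG0]
    exact squeeze_zero' (eventually_mem_nhdsWithin.mono hGnn)
      (eventually_mem_nhdsWithin.mono hGle) hlim
  have htop : Tendsto G atTop (𝓝 0) := by
    refine squeeze_zero' ((eventually_ge_atTop 0).mono hGnn) ((eventually_ge_atTop 0).mono hGle) ?_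
    simpa using (tendsto_rpow_mul_exp_neg_mul_atTop_nhds_zero s β hβ).mul_const C
  have hderiv : ∀ x ∈ Ioi (0 : ℝ), HasDerivAt G
      (s * (x ^ (s - 1) * Real.exp (-β * x) * upperIncGamma ν (α * x)) -
        β * (x ^ (s + 1 - 1) * Real.exp (-β * x) * upperIncGamma ν (α * x)) -
        α ^ ν * (x ^ (s + ν - 1) * Real.exp (-(α + β) * x))) x := by
    intro x hx
    have hx' : 0 < x := hx
    have h1 := Real.hasDerivAt_rpow_const (x := x) (p := s) (Or.inl hx'.ne')
    have h2 : HasDerivAt (fun x : ℝ ↦ Real.exp (-β * x)) (Real.exp (-β * x) * (-β)) x := by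
      simpa using ((hasDerivAt_id x).const_mul (-β)).exp
    have h3 : HasDerivAt (fun x ↦ upperIncGamma ν (α * x))
        (-((α * x) ^ (ν - 1) * Real.exp (-(α * x))) * α) x := by
      have hlin : HasDerivAt (fun x : ℝ ↦ α * x) α x := by
        simpa using (hasDerivAt_id x).const_mul α
      exact (hasDerivAt_upperIncGamma hν (mul_pos hα hx')).comp x hlin
    refine ((h1.mul h2).mul h3).congr_deriv ?_
    have e1 : Real.exp (-(α + β) * x) = Real.exp (-β * x) * Real.exp (-(α * x)) := by
      rw [← Real.exp_add]
      ring_nf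
    have e2 : α ^ ν = α ^ (ν - 1) * α := by
      rw [← Real.rpow_add_one hα.ne', sub_add_cancel]
    have e3 : x ^ (s + ν - 1) = x ^ s * x ^ (ν - 1) := by
      rw [← Real.rpow_add hx', add_sub_assoc]
    rw [e1, e2, e3, Real.mul_rpow hα.le hx'.le, add_sub_cancel_right]
    simp only [Pi.mul_apply]
    ring
  have hi1 := (integrableOn_rpow_mul_exp_mul_upperIncGamma hα hβ hs hν).const_mul s
  have hi2 :=
    (integrableOn_rpow_mul_exp_mul_upperIncGamma hα hβ (by positivity : 0 < s + 1) hν).const_mul β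
  have hi3 := (integrableOn_rpow_mul_exp_neg_mul hsν hαβ).const_mul (α ^ ν)
  have key := integral_Ioi_of_hasDerivAt_of_tendsto hcont hderiv ((hi1.sub hi2).sub hi3) htop
  rw [integral_sub (by exact hi1.sub hi2) hi3, integral_sub hi1 hi2, integral_const_mul,
    integral_const_mul, integral_const_mul, integral_rpow_mul_exp_neg_mul hsν hαβ, hG0] at key
  linarith

end LaplaceTransform

lemma Real.Gamma_add_nat_eq_ascPochhammer_mul {s : ℝ} (hs : 0 < s) (n : ℕ) :
    Real.Gamma (s + n) = (ascPochhammer ℝ n).eval s * Real.Gamma s := by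
  induction n with
  | zero => simp
  | succ n ih =>
    rw [ascPochhammer_succ_eval, Nat.cast_succ, ← add_assoc,
      Real.Gamma_add_one (by positivity), ih]
    ring

/-- `∫_0^∞ x^(μ-1) e^(-βx) Γ(ν, αx) dx
    = α^ν Γ(μ+ν) / (μ (α+β)^(μ+ν)) · ₂F₁(1, μ+ν; μ+1; β/(α+β))`. -/
theorem integral_upperIncGamma (α β μ ν : ℝ) (hα : 0 < α) (hβ : 0 < β) (hμ : 0 < μ)
    (hν : 0 < ν) :
    (∫ x in Set.Ioi (0:ℝ), x ^ (μ - 1) * Real.exp (-β * x) * upperIncGamma ν (α * x)) =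
      α ^ ν * Real.Gamma (μ + ν) / (μ * (α + β) ^ (μ + ν)) *
        gaussHypergeom 1 (μ + ν) (μ + 1) (β / (α + β)) := by
  set I : ℝ → ℝ := fun s ↦
    ∫ x in Ioi (0 : ℝ), x ^ (s - 1) * Real.exp (-β * x) * upperIncGamma ν (α * x) with hI
  set c : ℕ → ℝ := fun k ↦ β ^ k * Real.Gamma μ / Real.Gamma (μ + k) * I (μ + k) with hc
  have hΓ : ∀ k : ℕ, 0 < Real.Gamma (μ + k) := fun k ↦ Real.Gamma_pos_of_pos (by positivity)
  have hΓμ : 0 < Real.Gamma μ := Real.Gamma_pos_of_pos hμ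
  have hInn : ∀ s, 0 ≤ I s := fun s ↦ setIntegral_nonneg measurableSet_Ioi fun x hx ↦ by
    have hx' : 0 < x := hx
    exact mul_nonneg (by positivity) (upperIncGamma_nonneg ν (by positivity))
  have hc0 : c 0 = I μ := by simp [hc, hΓμ.ne']
  have hclim : Tendsto c atTop (𝓝 0) := by
    obtain ⟨C, hbound⟩ := exists_integral_upperIncGamma_le hα hβ hν
    set b := β + α / 2 with hb_def
    have hb : 0 < b := by positivity
    refine squeeze_zero (g := fun k ↦ C * Real.Gamma μ / b ^ μ * (β / b) ^ k)
      (fun k ↦ mul_nonneg (div_nonneg (by positivity) (hΓ k).le) (hInn _)) (fun k ↦ ?_) ?_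
    · have hk := hΓ k
      calc c k ≤ β ^ k * Real.Gamma μ / Real.Gamma (μ + k) *
            (C * (Real.Gamma (μ + k) / b ^ (μ + k))) := by
            simp only [hc]
            gcongr
            exact hbound _ (by positivity)
        _ = C * Real.Gamma μ / b ^ μ * (β / b) ^ k := by
            rw [Real.rpow_add_natCast hb.ne', div_pow]
            field_simp
    · have hr : β / b < 1 := by
        rw [div_lt_one hb]
        linarith
      simpa using (tendsto_pow_atTop_nhds_zero_of_lt_one (by positivity) hr).const_mul
        (C * Real.Gamma μ / b ^ μ)
  set term : ℕ → ℝ := fun k ↦ (ascPochhammer ℝ k).eval 1 * (ascPochhammer ℝ k).eval (μ + ν) /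
      (ascPochhammer ℝ k).eval (μ + 1) * (β / (α + β)) ^ k / (Nat.factorial k) with hterm
  set A := α ^ ν * Real.Gamma (μ + ν) / (μ * (α + β) ^ (μ + ν)) with hA
  have hΓμν : 0 < Real.Gamma (μ + ν) := Real.Gamma_pos_of_pos (by positivity)
  have hstep : ∀ k, A * term k = c k - c (k + 1) := by
    intro k
    have hrec := mul_integral_upperIncGamma_eq_add hα hβ (by positivity : 0 < μ + k) hν
    have hcast : μ + ((k + 1 : ℕ) : ℝ) = μ + k + 1 := by push_cast; ring
    have hμk : (0 : ℝ) < μ + k := by positivity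
    have hIk : I (μ + k) = (β * I (μ + k + 1) +
        α ^ ν * (Real.Gamma (μ + k + ν) / (α + β) ^ (μ + k + ν))) / (μ + k) := by
      rw [eq_div_iff hμk.ne', mul_comm]
      exact hrec
    have hp1 : 0 < (ascPochhammer ℝ k).eval (μ + 1) := ascPochhammer_pos k _ (by positivity)
    have hpΓ : (μ + k) * Real.Gamma (μ + k) =
        (ascPochhammer ℝ k).eval (μ + 1) * (μ * Real.Gamma μ) := by
      rw [← Real.Gamma_add_one hμk.ne', ← Real.Gamma_add_one hμ.ne',
        ← Real.Gamma_add_nat_eq_ascPochhammer_mul (by positivity), add_right_comm]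
    have hk := hΓ k
    have hαβ : 0 < α + β := by positivity
    have hsum : μ + k + ν = μ + ν + k := by ring
    simp only [hc, hterm, hA]
    rw [hcast, Real.Gamma_add_one hμk.ne', hIk, hsum,
      Real.Gamma_add_nat_eq_ascPochhammer_mul (by positivity : 0 < μ + ν),
      Real.rpow_add_natCast hαβ.ne', ascPochhammer_eval_one, div_pow]
    have hdiff : β ^ k * Real.Gamma μ / Real.Gamma (μ + k) * ((β * I (μ + k + 1) +
        α ^ ν * ((ascPochhammer ℝ k).eval (μ + ν) * Real.Gamma (μ + ν) /
          ((α + β) ^ (μ + ν) * (α + β) ^ k))) / (μ + k)) -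
        β ^ (k + 1) * Real.Gamma μ / ((μ + k) * Real.Gamma (μ + k)) * I (μ + k + 1) =
        β ^ k * Real.Gamma μ * (α ^ ν * ((ascPochhammer ℝ k).eval (μ + ν) * Real.Gamma (μ + ν) /
          ((α + β) ^ (μ + ν) * (α + β) ^ k))) / ((μ + k) * Real.Gamma (μ + k)) := by
      field_simp
      ring
    rw [hdiff, hpΓ]
    have hfact : (0 : ℝ) < Nat.factorial k := by positivity
    field_simp
  have hAterm : HasSum (fun k ↦ A * term k) (I μ) := by
    rw [hasSum_iff_tendsto_nat_of_nonneg]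
    · simp_rw [hstep, Finset.sum_range_sub', hc0]
      simpa using hclim.const_sub (I μ)
    · intro k
      have h1 : 0 < (ascPochhammer ℝ k).eval (1 : ℝ) := ascPochhammer_pos k _ one_pos
      have h2 : 0 < (ascPochhammer ℝ k).eval (μ + ν) := ascPochhammer_pos k _ (by positivity)
      have h3 : 0 < (ascPochhammer ℝ k).eval (μ + 1) := ascPochhammer_pos k _ (by positivity)
      positivity
  rw [gaussHypergeom, ← tsum_mul_left]
  exact hAterm.tsum_eq.symm
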